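/- Under the hypotheses in the context, det( δ_{j,k} + α_j·⟪R₀ v_k, v_j⟫ )_{j,k=1}^n = ∏_{k=1}^n b_k = ∏_{k=1}^n (1 + α_k·⟪R_{k−1} v_k, v_k⟫). -/

import Mathlib

open scoped InnerProductSpace

noncomputable section

/-- The recursively defined resolvents of successive rank-one perturbations (0-based
indexing): `R₀` is given, and
`R_{k+1} f = R_k f − (α_k ⟪R_k f, v_k⟫ / (1 + α_k ⟪R_k v_k, v_k⟫)) • R_k v_k`,
where `⟪a, b⟫` is linear in `a` and conjugate-linear in `b`
(so `⟪a, b⟫ = ⟪b, a⟫_ℂ` in Mathlib's convention). -/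
def resRec {H : Type*} [NormedAddCommGroup H] [InnerProductSpace ℂ H]
    (R0 : H → H) (α : ℕ → ℝ) (v : ℕ → H) : ℕ → H → H
  | 0 => R0
  | k + 1 => fun f =>
      resRec R0 α v k f -
        (((α k : ℂ) * ⟪v k, resRec R0 α v k f⟫_ℂ) /
            (1 + (α k : ℂ) * ⟪v k, resRec R0 α v k (v k)⟫_ℂ)) • resRec R0 α v k (v k)

theorem det_pivot_aux {m : ℕ} (M : Matrix (Fin (m + 1)) (Fin (m + 1)) ℂ) (h : M 0 0 ≠ 0) :
    M.det = M 0 0 *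
      (Matrix.of fun i j : Fin m =>
        M i.succ j.succ - M i.succ 0 * M 0 j.succ / M 0 0).det := by
  let c : Fin (m + 1) → ℂ := Fin.cases 0 (fun i => M i.succ 0 / M 0 0)
  let B : Matrix (Fin (m + 1)) (Fin (m + 1)) ℂ := Matrix.of fun i j => M i j - c i * M 0 j
  have hc : c 0 = 0 := rfl
  have hs : ∀ i : Fin m, c i.succ = M i.succ 0 / M 0 0 := fun i => rfl
  have h1 : M.det = B.det := by
    apply Matrix.det_eq_of_forall_row_eq_smul_add_const c 0 hc
    intro i j
    simp [B, hc]
  rw [h1, Matrix.det_succ_column_zero, Fin.sum_univ_succ, Finset.sum_eq_zero]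
  · have : B.submatrix (Fin.succAbove 0) Fin.succ = (Matrix.of fun i j : Fin m =>
        M i.succ j.succ - M i.succ 0 * M 0 j.succ / M 0 0) := by
      ext i j
      simp [B, hs]
      ring
    rw [this]
    simp [B, hc]
  · intro i _
    have : B i.succ 0 = 0 := by
      simp [B, hs, h]
    simp [this]

theorem resRec_shift_aux {H : Type*} [NormedAddCommGroup H] [InnerProductSpace ℂ H]
    (R0 : H → H) (α : ℕ → ℝ) (v : ℕ → H) (k : ℕ) :
    resRec (resRec R0 α v 1) (fun i => α (i + 1)) (fun i => v (i + 1)) k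
      = resRec R0 α v (k + 1) := by
  induction k with
  | zero => rfl
  | succ k ih =>
    rw [resRec, ih]
    rfl

theorem det_main_aux {H : Type*} [NormedAddCommGroup H] [InnerProductSpace ℂ H]
    (n : ℕ) : ∀ (α : ℕ → ℝ) (v : ℕ → H) (R0 : H → H)
    (_ : ∀ k : Fin n,
      (1 : ℂ) + (α (k : ℕ) : ℂ) * ⟪v (k : ℕ), resRec R0 α v (k : ℕ) (v (k : ℕ))⟫_ℂ ≠ 0),
    (Matrix.of fun j k : Fin n =>
        (if j = k then (1 : ℂ) else 0) + (α (j : ℕ) : ℂ) * ⟪v (j : ℕ), R0 (v (k : ℕ))⟫_ℂ).det =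
      ∏ k : Fin n,
        ((1 : ℂ) + (α (k : ℕ) : ℂ) * ⟪v (k : ℕ), resRec R0 α v (k : ℕ) (v (k : ℕ))⟫_ℂ) := by
  induction n with
  | zero => intros; simp
  | succ m ih =>
    intro α v R0 hb
    have h0 : (1 : ℂ) + (α 0 : ℂ) * ⟪v 0, R0 (v 0)⟫_ℂ ≠ 0 := hb 0
    have key := ih (fun i => α (i + 1)) (fun i => v (i + 1)) (resRec R0 α v 1) (by
      intro k
      rw [resRec_shift_aux]
      exact hb k.succ)
    simp only [resRec_shift_aux] at key
    rw [det_pivot_aux _ (by simpa using h0), Fin.prod_univ_succ]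
    simp only [Fin.val_succ, Fin.val_zero]
    rw [← key]
    congr 1
    · congr 1
      ext i j
      have e0 : (0 : Fin (m + 1)) ≠ j.succ := (Fin.succ_ne_zero j).symm
      simp only [Matrix.of_apply, resRec, inner_sub_right, inner_smul_right, Fin.succ_inj,
        Fin.val_succ, Fin.val_zero, if_neg e0, if_neg (Fin.succ_ne_zero i), if_true]
      ring

/-- Theorem 3.2. With `b_k = 1 + α_k ⟪R_{k−1} v_k, v_k⟫` assumed nonzero,
`det(δ_{j,k} + α_j ⟪R₀ v_k, v_j⟫) = ∏_k b_k`.  (Inner products below are written in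
Mathlib's convention `⟪x, y⟫_ℂ`, conjugate-linear in the first slot, so the paper's
`⟪R v_k, v_j⟫` is `⟪v_j, R v_k⟫_ℂ`.) -/
theorem statement19 {H : Type*} [NormedAddCommGroup H] [InnerProductSpace ℂ H]
    (n : ℕ) (hn : 1 ≤ n) (α : ℕ → ℝ) (hα : ∀ k : Fin n, α (k : ℕ) ≠ 0)
    (v : ℕ → H) (R0 : H →L[ℂ] H)
    (hb : ∀ k : Fin n,
      (1 : ℂ) + (α (k : ℕ) : ℂ) * ⟪v (k : ℕ), resRec (⇑R0) α v (k : ℕ) (v (k : ℕ))⟫_ℂ ≠ 0) :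
    (Matrix.of fun j k : Fin n =>
        (if j = k then (1 : ℂ) else 0) + (α (j : ℕ) : ℂ) * ⟪v (j : ℕ), R0 (v (k : ℕ))⟫_ℂ).det =
      ∏ k : Fin n,
        ((1 : ℂ) + (α (k : ℕ) : ℂ) * ⟪v (k : ℕ), resRec (⇑R0) α v (k : ℕ) (v (k : ℕ))⟫_ℂ) := by
  exact det_main_aux n α v R0 hb

end
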